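/- For every integer n = 2k+1 with k ≥ 2, every finite region R ⊆ ℤ² admits a signed tiling by the augmented tile set T̃_n consisting of the four tiles of T_n together with the 2×2 square tile S = {(0,0),(1,0),(0,1),(1,1)}. -/

import Mathlib

open scoped BigOperators Classical

/-- Translate a tile (a set of cells in `ℤ × ℤ`) by a vector `v`. -/
def tileTranslate (v : ℤ × ℤ) (T : Set (ℤ × ℤ)) : Set (ℤ × ℤ) := (fun c => v + c) '' T

/-- The ribbon L `n`-omino `T1 = {(0,j) : 0 ≤ j ≤ n-2} ∪ {(1,0)}`. -/
def T1 (n : ℕ) : Set (ℤ × ℤ) :=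
  {c | c.1 = 0 ∧ 0 ≤ c.2 ∧ c.2 ≤ (n : ℤ) - 2} ∪ {((1 : ℤ), (0 : ℤ))}

/-- The ribbon L `n`-omino `T2 = {(0,n-2)} ∪ {(1,j) : 0 ≤ j ≤ n-2}`. -/
def T2 (n : ℕ) : Set (ℤ × ℤ) :=
  {((0 : ℤ), (n : ℤ) - 2)} ∪ {c | c.1 = 1 ∧ 0 ≤ c.2 ∧ c.2 ≤ (n : ℤ) - 2}

/-- The ribbon L `n`-omino `T3 = {(i,0) : 0 ≤ i ≤ n-2} ∪ {(0,1)}`. -/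
def T3 (n : ℕ) : Set (ℤ × ℤ) :=
  {c | c.2 = 0 ∧ 0 ≤ c.1 ∧ c.1 ≤ (n : ℤ) - 2} ∪ {((0 : ℤ), (1 : ℤ))}

/-- The ribbon L `n`-omino `T4 = {(i,1) : 0 ≤ i ≤ n-2} ∪ {(n-2,0)}`. -/
def T4 (n : ℕ) : Set (ℤ × ℤ) :=
  {c | c.2 = 1 ∧ 0 ≤ c.1 ∧ c.1 ≤ (n : ℤ) - 2} ∪ {(((n : ℤ) - 2), (0 : ℤ))}

/-- The tile set `T_n` of the four ribbon L `n`-ominoes. -/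
def TileSet (n : ℕ) : Set (Set (ℤ × ℤ)) := {T1 n, T2 n, T3 n, T4 n}

/-- `w` is a signed tiling of the region `R` by the tile set `tiles`:
a finitely supported integer weight on placements `(T, v)`, supported on placements of
tiles from `tiles`, such that for each cell the weights of placements covering it sum to
`1` inside `R` and `0` outside. -/
def IsSignedTiling (tiles : Set (Set (ℤ × ℤ))) (R : Set (ℤ × ℤ))
    (w : Set (ℤ × ℤ) × (ℤ × ℤ) → ℤ) : Prop :=
  (Function.support w).Finite ∧
  (∀ p, w p ≠ 0 → p.1 ∈ tiles) ∧
  ∀ c : ℤ × ℤ,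
    (∑ᶠ p ∈ {p : Set (ℤ × ℤ) × (ℤ × ℤ) | c ∈ tileTranslate p.2 p.1}, w p) =
      if c ∈ R then 1 else 0

/-- `P` is a (regular) tiling of the region `R` by the tile set `tiles`: a finite
collection of placements of tiles from `tiles` whose translated copies are pairwise
disjoint and cover exactly `R`. -/
def IsTiling (tiles : Set (Set (ℤ × ℤ))) (R : Set (ℤ × ℤ))
    (P : Finset (Set (ℤ × ℤ) × (ℤ × ℤ))) : Prop :=
  (∀ p ∈ P, p.1 ∈ tiles) ∧
  (∀ p ∈ P, ∀ q ∈ P, p ≠ q → Disjoint (tileTranslate p.2 p.1) (tileTranslate q.2 q.1)) ∧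
  (⋃ p ∈ P, tileTranslate p.2 p.1) = R

/-- The `p × q` rectangle (height `p`, base `q`) with lower-left corner at the origin. -/
def Rect (p q : ℕ) : Set (ℤ × ℤ) :=
  {c | 0 ≤ c.1 ∧ c.1 ≤ (q : ℤ) - 1 ∧ 0 ≤ c.2 ∧ c.2 ≤ (p : ℤ) - 1}

/-- The `2 × 2` square tile `S = {(0,0),(1,0),(0,1),(1,1)}`. -/
def SquareTile : Set (ℤ × ℤ) :=
  {((0 : ℤ), (0 : ℤ)), ((1 : ℤ), (0 : ℤ)), ((0 : ℤ), (1 : ℤ)), ((1 : ℤ), (1 : ℤ))}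

/-- The augmented tile set `T̃_n = T_n ∪ {S}`. -/
def TileSetAug (n : ℕ) : Set (Set (ℤ × ℤ)) := TileSet n ∪ {SquareTile}

/-- A sum of `2 * k` consecutive terms is a sum of `k` sums of two consecutive terms. -/
lemma sum_range_two_mul {A : Type*} [AddCommMonoid A] (f : ℕ → A) (k : ℕ) :
    ∑ j ∈ Finset.range (2 * k), f j = ∑ i ∈ Finset.range k, (f (2 * i) + f (2 * i + 1)) := by
  induction k with
  | zero => simp
  | succ k ih => rw [Nat.mul_succ, Finset.sum_range_succ, Finset.sum_range_succ, ih,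
      Finset.sum_range_succ, add_assoc]

/-- Squares and L-shapes with an even leg generate the dominoes perpendicular to that leg. -/
lemma domino_mem {A : Type*} [AddCommGroup A] (G : AddSubgroup A) (D : ℤ → ℤ → A) (k : ℕ)
    (hS : ∀ a b, D a b + D (a + 1) b + D a (b + 1) + D (a + 1) (b + 1) ∈ G)
    (hL : ∀ a b, ∑ j ∈ Finset.range (2 * k), D a (b + j) + D (a + 1) b ∈ G) (a b : ℤ) :
    D a b + D (a + 1) b ∈ G := by
  have hsq : ∑ j ∈ Finset.range (2 * k), (D (a - 1) (b + j) + D a (b + j)) ∈ G := by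
    rw [sum_range_two_mul]
    refine G.sum_mem fun i _ => ?_
    have h := hS (a - 1) (b + (2 * i : ℕ))
    rw [sub_add_cancel] at h
    convert h using 1
    push_cast
    rw [← add_assoc b]
    abel
  have h := G.sub_mem (G.add_mem (hL (a - 1) b) (hL a b)) hsq
  rw [sub_add_cancel] at h
  convert h using 1
  rw [Finset.sum_add_distrib]
  abel

/-- Squares and the two L-shapes with even legs generate the single cells. -/
lemma cell_mem {A : Type*} [AddCommGroup A] (G : AddSubgroup A) (D : ℤ → ℤ → A) (k : ℕ)
    (hS : ∀ a b, D a b + D (a + 1) b + D a (b + 1) + D (a + 1) (b + 1) ∈ G)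
    (hV : ∀ a b, ∑ j ∈ Finset.range (2 * k), D a (b + j) + D (a + 1) b ∈ G)
    (hH : ∀ a b, ∑ i ∈ Finset.range (2 * k), D (a + i) b + D a (b + 1) ∈ G) (a b : ℤ) :
    D a b ∈ G := by
  have hdom (a b : ℤ) : D a b + D a (b + 1) ∈ G := by
    refine domino_mem G (fun b a => D a b) k (fun b a => ?_) (fun b a => hH a b) b a
    convert hS a b using 1
    abel
  have hcol : ∑ j ∈ Finset.range (2 * k), D (a - 1) (b + j) ∈ G := by
    rw [sum_range_two_mul]
    refine G.sum_mem fun i _ => ?_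
    convert hdom (a - 1) (b + (2 * i : ℕ)) using 3
    push_cast
    ring
  simpa using G.sub_mem (hV (a - 1) b) hcol

lemma mem_tileTranslate {v c : ℤ × ℤ} {T : Set (ℤ × ℤ)} : c ∈ tileTranslate v T ↔ c - v ∈ T := by
  constructor
  · rintro ⟨d, hd, rfl⟩
    simpa using hd
  · exact fun h => ⟨c - v, h, by simp⟩

/-- The subgroup of functions generated by the indicators of translates of the given tiles. -/
def tileSpan (tiles : Set (Set (ℤ × ℤ))) : AddSubgroup (ℤ × ℤ → ℤ) :=
  AddSubgroup.closure {f | ∃ T ∈ tiles, ∃ v, f = fun c => if c - v ∈ T then 1 else 0}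

lemma exists_weight_of_mem_tileSpan {tiles : Set (Set (ℤ × ℤ))} {f : ℤ × ℤ → ℤ}
    (hf : f ∈ tileSpan tiles) :
    ∃ w : Set (ℤ × ℤ) × (ℤ × ℤ) → ℤ, (Function.support w).Finite ∧
      (∀ p, w p ≠ 0 → p.1 ∈ tiles) ∧
      ∀ c, (∑ᶠ p ∈ {p : Set (ℤ × ℤ) × (ℤ × ℤ) | c ∈ tileTranslate p.2 p.1}, w p) = f c := by
  induction hf using AddSubgroup.closure_induction with
  | mem f hf =>
    obtain ⟨T, hT, v, rfl⟩ := hf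
    refine ⟨Pi.single (T, v) 1, (Set.finite_singleton (T, v)).subset (by simp), ?_, fun c => ?_⟩
    · intro p hp
      have : p = (T, v) := by
        by_contra h
        exact hp (Pi.single_eq_of_ne h 1)
      rwa [this]
    · rw [finsum_eq_single _ (T, v) fun p hp => by simp [Pi.single_eq_of_ne hp]]
      by_cases h : c - v ∈ T <;> simp [mem_tileTranslate, h]
  | zero => exact ⟨0, by simp, by simp, by simp⟩
  | add f g _ _ hf hg =>
    obtain ⟨u, hu, hut, huf⟩ := hf
    obtain ⟨w, hw, hwt, hwg⟩ := hg
    refine ⟨u + w, (hu.union hw).subset (Function.support_add u w), fun p hp => ?_, fun c => ?_⟩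
    · by_cases h : u p = 0
      · exact hwt p (by simpa [h] using hp)
      · exact hut p h
    · rw [Pi.add_apply, ← huf, ← hwg]
      exact finsum_mem_add_distrib' (hu.inter_of_right _) (hw.inter_of_right _)
  | neg f _ hf =>
    obtain ⟨u, hu, hut, huf⟩ := hf
    refine ⟨-u, by rwa [Function.support_neg], fun p hp => hut p (by simpa using hp), fun c => ?_⟩
    simp only [Pi.neg_apply, finsum_neg_distrib, huf]

/-- The indicator function of the cell `(a, b)`. -/
def cellIndicator (a b : ℤ) : ℤ × ℤ → ℤ := fun c => if c.1 = a ∧ c.2 = b then 1 else 0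

lemma sum_cellIndicator_vertical (a b : ℤ) (m : ℕ) (c : ℤ × ℤ) :
    ∑ j ∈ Finset.range m, cellIndicator a (b + j) c =
      if c.1 = a ∧ b ≤ c.2 ∧ c.2 < b + m then 1 else 0 := by
  induction m with
  | zero => rw [if_neg (by push_cast; omega)]; simp
  | succ m ih =>
    rw [Finset.sum_range_succ, ih, cellIndicator]
    push_cast
    split_ifs <;> omega

lemma sum_cellIndicator_horizontal (a b : ℤ) (m : ℕ) (c : ℤ × ℤ) :
    ∑ i ∈ Finset.range m, cellIndicator (a + i) b c =
      if c.2 = b ∧ a ≤ c.1 ∧ c.1 < a + m then 1 else 0 := by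
  simpa [cellIndicator, and_comm] using sum_cellIndicator_vertical b a m c.swap

lemma cellIndicator_mem_tileSpan (k : ℕ) (a b : ℤ) :
    cellIndicator a b ∈ tileSpan (TileSetAug (2 * k + 1)) := by
  refine cell_mem _ cellIndicator k (fun a b => ?_) (fun a b => ?_) (fun a b => ?_) a b
  · refine AddSubgroup.subset_closure ⟨SquareTile, by simp [TileSetAug], (a, b), ?_⟩
    ext c
    simp only [Pi.add_apply, cellIndicator, SquareTile, Set.mem_insert_iff,
      Set.mem_singleton_iff, Prod.ext_iff, Prod.fst_sub, Prod.snd_sub]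
    split_ifs <;> omega
  · refine AddSubgroup.subset_closure
      ⟨T1 (2 * k + 1), by simp [TileSetAug, TileSet], (a, b), ?_⟩
    ext c
    rw [Pi.add_apply, Finset.sum_apply, sum_cellIndicator_vertical]
    simp only [cellIndicator, T1, Set.mem_union, Set.mem_ofPred_eq,
      Set.mem_singleton_iff, Prod.ext_iff, Prod.fst_sub, Prod.snd_sub]
    push_cast
    split_ifs <;> omega
  · refine AddSubgroup.subset_closure
      ⟨T3 (2 * k + 1), by simp [TileSetAug, TileSet], (a, b), ?_⟩
    ext c
    rw [Pi.add_apply, Finset.sum_apply, sum_cellIndicator_horizontal]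
    simp only [cellIndicator, T3, Set.mem_union, Set.mem_ofPred_eq,
      Set.mem_singleton_iff, Prod.ext_iff, Prod.fst_sub, Prod.snd_sub]
    push_cast
    split_ifs <;> omega

/-- For every integer `n = 2k+1` with `k ≥ 2`, every finite region `R ⊆ ℤ²` admits a
signed tiling by the augmented tile set `T̃_n`. -/
theorem signed_tiling_of_aug (k : ℕ) (hk : 2 ≤ k) (R : Set (ℤ × ℤ)) (hR : R.Finite) :
    ∃ w, IsSignedTiling (TileSetAug (2 * k + 1)) R w := by
  have h : ∑ r ∈ hR.toFinset, cellIndicator r.1 r.2 ∈ tileSpan (TileSetAug (2 * k + 1)) :=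
    AddSubgroup.sum_mem _ fun r _ => cellIndicator_mem_tileSpan k r.1 r.2
  obtain ⟨w, hw, hwt, hwc⟩ := exists_weight_of_mem_tileSpan h
  refine ⟨w, hw, hwt, fun c => (hwc c).trans ?_⟩
  simp [Finset.sum_apply, cellIndicator, ← Prod.ext_iff]
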